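/- arXiv:1001.4073 — 5 statements merged into one kernel-verified Lean document; each statement's English description precedes it below -/
import Mathlib

section
/- Under the Grushin problem setup, if A : X → Y is bijective with bounded inverse, then E₋₊ : H → H is bijective and E₋₊⁻¹ = − R₊ ∘ A⁻¹ ∘ R₋. -/
/-- Grushin problem: if `A` is bijective with bounded inverse `B`, then the effective
Hamiltonian `E₋₊` is bijective and `E₋₊⁻¹ = −R₊ ∘ A⁻¹ ∘ R₋`. -/
theorem grushin_effective_hamiltonian_inverse
    {X Y H : Type*}
    [NormedAddCommGroup X] [NormedSpace ℂ X]
    [NormedAddCommGroup Y] [NormedSpace ℂ Y]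
    [NormedAddCommGroup H] [NormedSpace ℂ H]
    (A : X →L[ℂ] Y) (Rm : H →L[ℂ] Y) (Rp : X →L[ℂ] H)
    (P : (X × H) →L[ℂ] (Y × H)) (Einv : (Y × H) →L[ℂ] (X × H))
    (E : Y →L[ℂ] X) (Ep : H →L[ℂ] X) (Em : Y →L[ℂ] H) (Emp : H →L[ℂ] H)
    (hP : ∀ (u : X) (um : H), P (u, um) = (A u + Rm um, Rp u))
    (hPE : ∀ w : Y × H, P (Einv w) = w)
    (hEP : ∀ w : X × H, Einv (P w) = w)
    (hE : ∀ (v : Y) (vp : H), Einv (v, vp) = (E v + Ep vp, Em v + Emp vp))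
    (B : Y →L[ℂ] X)
    (hB1 : ∀ x : X, B (A x) = x)
    (hB2 : ∀ y : Y, A (B y) = y) :
    Function.Bijective Emp ∧
      (∀ w : H, Emp ((-(Rp.comp (B.comp Rm))) w) = w) ∧
      (∀ w : H, (-(Rp.comp (B.comp Rm))) (Emp w) = w) := by
  have right_inv : ∀ w : H, Emp ((-(Rp.comp (B.comp Rm))) w) = w := by
    intro w
    have h := hEP (-(B (Rm w)), w)
    rw [hP, hE] at h
    simpa [hB2] using congrArg Prod.snd h
  have left_inv : ∀ w : H, (-(Rp.comp (B.comp Rm))) (Emp w) = w := by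
    intro w
    have h := hPE (0, w)
    rw [hE, hP, Prod.mk.injEq] at h
    simp only [map_zero, zero_add] at h
    have hEp : Ep w = -(B (Rm (Emp w))) := by
      rw [← hB1 (Ep w), eq_neg_of_add_eq_zero_left h.1, map_neg]
    simpa [hEp] using h.2
  exact ⟨Function.bijective_iff_has_inverse.mpr ⟨_, left_inv, right_inv⟩, right_inv, left_inv⟩
end

section
/- Under the Grushin problem setup with finite-dimensional auxiliary space H = ℂ^r, the operator A : X → Y is bijective if and only if det(I_r − (I_r − E₋₊)) = det(E₋₊) ≠ 0, where E₋₊ is identified with an r × r complex matrix via the standard basis of ℂ^r. -/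
namespace LinearMap

variable {R X Y V W : Type*} [Ring R] [AddCommGroup X] [AddCommGroup Y] [AddCommGroup V]
  [AddCommGroup W] [Module R X] [Module R Y] [Module R V] [Module R W]

/-- If the first column of the product of the block operators `(E, F; G, H)` and `(A, B; C, D)` is
that of the identity, injectivity passes from `H` to the complementary block `A`. -/
theorem injective_of_complementary_block {A : X →ₗ[R] Y} {C : X →ₗ[R] W} {E : Y →ₗ[R] X}
    {F : W →ₗ[R] X} {G : Y →ₗ[R] V} {H : W →ₗ[R] V}
    (h₁ : ∀ u, E (A u) + F (C u) = u) (h₂ : ∀ u, G (A u) + H (C u) = 0)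
    (hH : Function.Injective H) : Function.Injective A := by
  refine (injective_iff_map_eq_zero A).2 fun u hu => ?_
  have hC : C u = 0 := (injective_iff_map_eq_zero H).1 hH _ (by simpa [hu] using h₂ u)
  simpa [hu, hC] using (h₁ u).symm

/-- If the first row of the product of the block operators `(A, B; C, D)` and `(E, F; G, H)` is
that of the identity, surjectivity passes from `H` to the complementary block `A`. -/
theorem surjective_of_complementary_block {A : X →ₗ[R] Y} {B : V →ₗ[R] Y} {E : Y →ₗ[R] X}
    {F : W →ₗ[R] X} {G : Y →ₗ[R] V} {H : W →ₗ[R] V}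
    (h₁ : ∀ v, A (E v) + B (G v) = v) (h₂ : ∀ w, A (F w) + B (H w) = 0)
    (hH : Function.Surjective H) : Function.Surjective A := by
  intro v
  obtain ⟨w, hw⟩ := hH (-G v)
  refine ⟨E v + F w, ?_⟩
  have hF : A (F w) = B (G v) := by simpa [hw, add_neg_eq_zero] using h₂ w
  rw [map_add, hF, h₁]

/-- For mutually inverse block operators `(A, B; C, D)` and `(E, F; G, H)`, the block `A` is
bijective iff the complementary block `H` of the inverse is. -/
theorem bijective_iff_complementary_block {A : X →ₗ[R] Y} {B : V →ₗ[R] Y} {C : X →ₗ[R] W}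
    {D : V →ₗ[R] W} {E : Y →ₗ[R] X} {F : W →ₗ[R] X} {G : Y →ₗ[R] V} {H : W →ₗ[R] V}
    (hAE : ∀ v, A (E v) + B (G v) = v) (hAF : ∀ w, A (F w) + B (H w) = 0)
    (hCF : ∀ w, C (F w) + D (H w) = w)
    (hEA : ∀ u, E (A u) + F (C u) = u) (hGA : ∀ u, G (A u) + H (C u) = 0)
    (hGB : ∀ z, G (B z) + H (D z) = z) :
    Function.Bijective A ↔ Function.Bijective H := by
  constructor
  · rintro ⟨hi, hs⟩
    exact ⟨injective_of_complementary_block (fun w => (add_comm _ _).trans (hCF w))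
        (fun w => (add_comm _ _).trans (hAF w)) hi,
      surjective_of_complementary_block (fun z => (add_comm _ _).trans (hGB z))
        (fun u => (add_comm _ _).trans (hGA u)) hs⟩
  · rintro ⟨hi, hs⟩
    exact ⟨injective_of_complementary_block hEA hGA hi,
      surjective_of_complementary_block hAE hAF hs⟩

/-- An endomorphism of `n → K` is bijective iff its standard matrix has nonzero determinant. -/
theorem bijective_iff_det_toMatrix'_ne_zero {K n : Type*} [Field K] [Fintype n] [DecidableEq n]
    (f : (n → K) →ₗ[K] (n → K)) : Function.Bijective f ↔ (toMatrix' f).det ≠ 0 := by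
  rw [← Module.End.isUnit_iff, LinearMap.det_toMatrix', ← isUnit_iff_ne_zero,
    LinearMap.isUnit_iff_isUnit_det]

end LinearMap


/-- Grushin problem with finite-dimensional auxiliary space `ℂ^r`: the operator `A`
is bijective iff `det(I − (I − E₋₊)) = det E₋₊ ≠ 0`, where `E₋₊` is identified with an
`r × r` complex matrix via the standard basis. -/
theorem grushin_bijective_iff_det_ne_zero
    {X Y : Type*}
    [NormedAddCommGroup X] [NormedSpace ℂ X]
    [NormedAddCommGroup Y] [NormedSpace ℂ Y]
    (r : ℕ)
    (A : X →L[ℂ] Y) (Rm : (Fin r → ℂ) →L[ℂ] Y) (Rp : X →L[ℂ] (Fin r → ℂ))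
    (P : (X × (Fin r → ℂ)) →L[ℂ] (Y × (Fin r → ℂ)))
    (Einv : (Y × (Fin r → ℂ)) →L[ℂ] (X × (Fin r → ℂ)))
    (E : Y →L[ℂ] X) (Ep : (Fin r → ℂ) →L[ℂ] X) (Em : Y →L[ℂ] (Fin r → ℂ))
    (Emp : (Fin r → ℂ) →L[ℂ] (Fin r → ℂ))
    (hP : ∀ (u : X) (um : Fin r → ℂ), P (u, um) = (A u + Rm um, Rp u))
    (hPE : ∀ w : Y × (Fin r → ℂ), P (Einv w) = w)
    (hEP : ∀ w : X × (Fin r → ℂ), Einv (P w) = w)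
    (hE : ∀ (v : Y) (vp : Fin r → ℂ), Einv (v, vp) = (E v + Ep vp, Em v + Emp vp))
    (M : Matrix (Fin r) (Fin r) ℂ)
    (hM : M = LinearMap.toMatrix' (Emp : (Fin r → ℂ) →ₗ[ℂ] (Fin r → ℂ))) :
    Matrix.det (1 - (1 - M)) = Matrix.det M ∧
      (Function.Bijective A ↔ Matrix.det (1 - (1 - M)) ≠ 0) := by
  subst hM
  rw [sub_sub_cancel]
  refine ⟨rfl, ?_⟩
  rw [← LinearMap.bijective_iff_det_toMatrix'_ne_zero]
  have hPE₁ : ∀ v w, A (E v + Ep w) + Rm (Em v + Emp w) = v := fun v w => by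
    simpa only [hE, hP] using congrArg Prod.fst (hPE (v, w))
  have hPE₂ : ∀ v w, Rp (E v + Ep w) = w := fun v w => by
    simpa only [hE, hP] using congrArg Prod.snd (hPE (v, w))
  have hEP₁ : ∀ u z, E (A u + Rm z) + Ep (Rp u) = u := fun u z => by
    simpa only [hE, hP] using congrArg Prod.fst (hEP (u, z))
  have hEP₂ : ∀ u z, Em (A u + Rm z) + Emp (Rp u) = z := fun u z => by
    simpa only [hE, hP] using congrArg Prod.snd (hEP (u, z))
  exact LinearMap.bijective_iff_complementary_block (A := (A : X →ₗ[ℂ] Y))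
    (B := (Rm : (Fin r → ℂ) →ₗ[ℂ] Y)) (C := (Rp : X →ₗ[ℂ] (Fin r → ℂ))) (D := 0)
    (E := (E : Y →ₗ[ℂ] X)) (F := (Ep : (Fin r → ℂ) →ₗ[ℂ] X))
    (G := (Em : Y →ₗ[ℂ] (Fin r → ℂ)))
    (fun v => by simpa using hPE₁ v 0) (fun w => by simpa using hPE₁ 0 w)
    (fun w => by simpa using hPE₂ 0 w) (fun u => by simpa using hEP₁ u 0)
    (fun u => by simpa using hEP₂ u 0) (fun z => by simpa using hEP₂ 0 z)
end

section
/- Under the Hamiltonian scattering setup, let (x, ξ) be a solution of the Hamiltonian system with constant energy E > 0. If at some time t₀ one has |x(t₀)| ≥ R₀ and ⟨x(t₀), ξ(t₀)⟩ ≥ 0, then for all t ≥ t₀ one has |x(t)|² ≥ |x(t₀)|² + 2E(t − t₀)²; in particular |x(t)| → ∞ as t → +∞, so the trajectory escapes to infinity. -/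
open scoped RealInnerProductSpace

section Gradient

variable {F : Type*} [NormedAddCommGroup F] [InnerProductSpace ℝ F] [CompleteSpace F]

/-- The gradient of a smooth function is smooth. -/
lemma ContDiff.contDiff_gradient {V : F → ℝ} (hV : ContDiff ℝ (⊤ : ℕ∞) V) :
    ContDiff ℝ 1 (gradient V) := by
  have h : ContDiff ℝ 1 (fderiv ℝ V) :=
    (contDiff_infty_iff_fderiv.1 hV).2.of_le (by exact_mod_cast le_top)
  exact (InnerProductSpace.toDual ℝ F).symm.contDiff.comp h

/-- A smooth function supported in an open ball has vanishing gradient outside that ball,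
the boundary sphere included. -/
lemma gradient_eq_zero_of_support_subset_ball {V : F → ℝ} (hV : ContDiff ℝ (⊤ : ℕ∞) V) {R : ℝ}
    (hR : 0 < R) (hsupp : Function.support V ⊆ Metric.ball 0 R) {p : F} (hp : R ≤ ‖p‖) :
    gradient V p = 0 := by
  have hclosed : IsClosed {q | gradient V q = 0} :=
    isClosed_eq hV.contDiff_gradient.continuous continuous_const
  have hsub : (Metric.closedBall (0 : F) R)ᶜ ⊆ {q | gradient V q = 0} := by
    intro q hq
    have hq' : q ∉ tsupport V := fun h =>
      hq (Metric.closure_ball_subset_closedBall (closure_mono hsupp h))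
    have : fderiv ℝ V q = 0 := by
      by_contra h
      exact hq' (support_fderiv_subset ℝ h)
    simp [gradient, this]
  refine hclosed.closure_subset_iff.2 hsub ?_
  rw [closure_compl, interior_closedBall _ hR.ne']
  simpa using hp

end Gradient

/-- Two forward solutions of an autonomous ODE with a `C¹` vector field that agree at an initial
time agree at all later times. -/
lemma ContDiff.ode_solution_unique_right {F : Type*} [NormedAddCommGroup F] [NormedSpace ℝ F]
    {v : F → F} (hv : ContDiff ℝ 1 v) {f g : ℝ → F} {a t : ℝ} (hat : a ≤ t)
    (hfc : Continuous f) (hgc : Continuous g)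
    (hf : ∀ s, a ≤ s → HasDerivAt f (v (f s)) s) (hg : ∀ s, a ≤ s → HasDerivAt g (v (g s)) s)
    (h : f a = g a) : f t = g t := by
  have hK : IsCompact (f '' Set.Icc a t ∪ g '' Set.Icc a t) :=
    (isCompact_Icc.image hfc).union (isCompact_Icc.image hgc)
  obtain ⟨K, hK⟩ := LocallyLipschitzOn.exists_lipschitzOnWith_of_compact hK
    hv.locallyLipschitz.locallyLipschitzOn
  exact ODE_solution_unique_of_mem_Icc_right (v := fun _ => v) (fun _ _ => hK)
    hfc.continuousOn (fun s hs => (hf s hs.1).hasDerivWithinAt)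
    (fun s hs => Or.inl ⟨s, Set.Ico_subset_Icc_self hs, rfl⟩)
    hgc.continuousOn (fun s hs => (hg s hs.1).hasDerivWithinAt)
    (fun s hs => Or.inr ⟨s, Set.Ico_subset_Icc_self hs, rfl⟩) h ⟨hat, le_rfl⟩

/-- An outgoing straight line moves away from the origin at least quadratically. -/
lemma norm_sq_add_le_norm_add_smul_sq {F : Type*} [NormedAddCommGroup F] [InnerProductSpace ℝ F]
    {p w : F} (h : 0 ≤ ⟪p, w⟫) {s : ℝ} (hs : 0 ≤ s) :
    ‖p‖ ^ 2 + ‖w‖ ^ 2 * s ^ 2 ≤ ‖p + s • w‖ ^ 2 := by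
  rw [norm_add_sq_real, inner_smul_right, norm_smul, mul_pow, Real.norm_eq_abs, sq_abs]
  nlinarith [mul_nonneg hs h]

/-- Escape to infinity: if a solution of the Hamiltonian system with constant energy
`E > 0` satisfies `|x(t₀)| ≥ R₀` and `⟨x(t₀), ξ(t₀)⟩ ≥ 0` at some time `t₀`, then
`|x(t)|² ≥ |x(t₀)|² + 2E(t − t₀)²` for all `t ≥ t₀`; in particular `|x(t)| → ∞` as
`t → +∞`. -/
theorem hamiltonian_escape_to_infinity
    (n : ℕ) (hn : 1 ≤ n) (R₀ : ℝ) (hR₀ : 0 < R₀)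
    (V : EuclideanSpace ℝ (Fin n) → ℝ)
    (hV : ContDiff ℝ (⊤ : ℕ∞) V)
    (hsupp : Function.support V ⊆ Metric.ball (0 : EuclideanSpace ℝ (Fin n)) R₀)
    (x ξ : ℝ → EuclideanSpace ℝ (Fin n))
    (hx : ∀ t : ℝ, HasDerivAt x (ξ t) t)
    (hξ : ∀ t : ℝ, HasDerivAt ξ (-(gradient V (x t))) t)
    (E : ℝ) (hE : 0 < E)
    (henergy : ∀ t : ℝ, ‖ξ t‖ ^ 2 / 2 + V (x t) = E)
    (t₀ : ℝ)
    (hxt₀ : R₀ ≤ ‖x t₀‖)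
    (hout : 0 ≤ ⟪x t₀, ξ t₀⟫) :
    (∀ t : ℝ, t₀ ≤ t → ‖x t₀‖ ^ 2 + 2 * E * (t - t₀) ^ 2 ≤ ‖x t‖ ^ 2) ∧
      Filter.Tendsto (fun t : ℝ => ‖x t‖) Filter.atTop Filter.atTop := by
  have hgrad : ∀ p : EuclideanSpace ℝ (Fin n), R₀ ≤ ‖p‖ → gradient V p = 0 :=
    fun p hp => gradient_eq_zero_of_support_subset_ball hV hR₀ hsupp hp
  have hspeed : ‖ξ t₀‖ ^ 2 = 2 * E := by
    have hV₀ : V (x t₀) = 0 := by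
      by_contra h
      have := hsupp h
      rw [mem_ball_zero_iff] at this
      linarith
    have := henergy t₀
    rw [hV₀] at this
    linarith
  have hline : ∀ t, t₀ ≤ t →
      ‖x t₀‖ ^ 2 + 2 * E * (t - t₀) ^ 2 ≤ ‖x t₀ + (t - t₀) • ξ t₀‖ ^ 2 := fun t ht =>
    hspeed ▸ norm_sq_add_le_norm_add_smul_sq hout (sub_nonneg.2 ht)
  have hout_line : ∀ t, t₀ ≤ t → R₀ ≤ ‖x t₀ + (t - t₀) • ξ t₀‖ := fun t ht => by
    refine hxt₀.trans (le_of_abs_le (abs_le_of_sq_le_sq ?_ (norm_nonneg _)))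
    have : 0 ≤ 2 * E * (t - t₀) ^ 2 := by positivity
    linarith [hline t ht]
  have hfree : ∀ t, t₀ ≤ t → x t = x t₀ + (t - t₀) • ξ t₀ := fun t ht => by
    have hderiv : ∀ s, HasDerivAt (fun s => x t₀ + (s - t₀) • ξ t₀) (ξ t₀) s := fun s => by
      simpa using (((hasDerivAt_id s).sub_const t₀).smul_const (ξ t₀)).const_add (x t₀)
    have hv : ContDiff ℝ 1
        (fun p : EuclideanSpace ℝ (Fin n) × EuclideanSpace ℝ (Fin n) =>
          (p.2, -(gradient V p.1))) :=
      contDiff_snd.prodMk (hV.contDiff_gradient.comp contDiff_fst).neg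
    have hsol := fun s => (hx s).prodMk (hξ s)
    have hsol' := fun s => (hderiv s).prodMk (hasDerivAt_const s (ξ t₀))
    have := hv.ode_solution_unique_right (f := fun s => (x s, ξ s))
      (g := fun s => (x t₀ + (s - t₀) • ξ t₀, ξ t₀)) ht
      (continuous_iff_continuousAt.2 fun s => (hsol s).continuousAt)
      (continuous_iff_continuousAt.2 fun s => (hsol' s).continuousAt)
      (fun s _ => hsol s)
      (fun s hs => by simpa [hgrad _ (hout_line s hs)] using hsol' s) (by simp)
    exact congrArg Prod.fst this
  have hmain : ∀ t, t₀ ≤ t → ‖x t₀‖ ^ 2 + 2 * E * (t - t₀) ^ 2 ≤ ‖x t‖ ^ 2 := fun t ht => by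
    rw [hfree t ht]
    exact hline t ht
  refine ⟨hmain, ?_⟩
  have hlin : Filter.Tendsto (fun t : ℝ => √(2 * E) * (t - t₀)) Filter.atTop Filter.atTop :=
    (Filter.tendsto_atTop_add_const_right _ (-t₀) Filter.tendsto_id).const_mul_atTop (by positivity)
  refine Filter.tendsto_atTop_mono' _ ?_ hlin
  filter_upwards [Filter.eventually_ge_atTop t₀] with t ht
  refine le_of_abs_le (abs_le_of_sq_le_sq ?_ (norm_nonneg _))
  rw [mul_pow, Real.sq_sqrt (by positivity)]
  linarith [hmain t ht, sq_nonneg ‖x t₀‖]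
end

section
/- Under the Hamiltonian scattering setup, for every E > 0 the trapped set K_E is a compact subset of ℝⁿ × ℝⁿ. -/
/-- The trapped set at energy `E`: points of the energy shell whose trajectory under
the Hamiltonian flow of `p(x,ξ) = |ξ|²/2 + V(x)` stays bounded for all times. -/
def trappedSet (n : ℕ) (V : EuclideanSpace ℝ (Fin n) → ℝ) (E : ℝ) :
    Set (EuclideanSpace ℝ (Fin n) × EuclideanSpace ℝ (Fin n)) :=
  {p | ‖p.2‖ ^ 2 / 2 + V p.1 = E ∧
    ∃ x ξ : ℝ → EuclideanSpace ℝ (Fin n),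
      (∀ t : ℝ, HasDerivAt x (ξ t) t) ∧
      (∀ t : ℝ, HasDerivAt ξ (-(gradient V (x t))) t) ∧
      x 0 = p.1 ∧ ξ 0 = p.2 ∧ ∃ C : ℝ, ∀ t : ℝ, ‖x t‖ ≤ C}

open Filter Topology Set
open scoped NNReal

section GlobalTrajectories

variable {Z : Type*} [NormedAddCommGroup Z] [NormedSpace ℝ Z]

/-- Grönwall's estimate for two global trajectories of a Lipschitz vector field, in both time
directions. -/
theorem dist_le_of_global_trajectories {F : Z → Z} {K : ℝ≥0} (hF : LipschitzWith K F)
    {f g : ℝ → Z} (hf : ∀ t, HasDerivAt f (F (f t)) t) (hg : ∀ t, HasDerivAt g (F (g t)) t)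
    (t : ℝ) : dist (f t) (g t) ≤ dist (f 0) (g 0) * Real.exp (K * |t|) := by
  have forward : ∀ {F : Z → Z} {f g : ℝ → Z}, LipschitzWith K F →
      (∀ t, HasDerivAt f (F (f t)) t) → (∀ t, HasDerivAt g (F (g t)) t) → ∀ t, 0 ≤ t →
      dist (f t) (g t) ≤ dist (f 0) (g 0) * Real.exp (K * t) := by
    intro F f g hF hf hg t ht
    have h := dist_le_of_trajectories_ODE (v := fun _ => F) (K := K) (a := 0) (b := t)
      (f := f) (g := g) (δ := dist (f 0) (g 0)) (fun _ => hF)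
      (fun s _ => (hf s).continuousAt.continuousWithinAt) (fun s _ => (hf s).hasDerivWithinAt)
      (fun s _ => (hg s).continuousAt.continuousWithinAt) (fun s _ => (hg s).hasDerivWithinAt)
      le_rfl t ⟨ht, le_rfl⟩
    simpa using h
  rcases le_total 0 t with ht | ht
  · simpa [abs_of_nonneg ht] using forward hF hf hg t ht
  · have reverse : ∀ {f : ℝ → Z}, (∀ t, HasDerivAt f (F (f t)) t) →
        ∀ t, HasDerivAt (fun s => f (-s)) (-F (f (-t))) t := by
      intro f hf t
      simpa [Function.comp_def] using (hf (-t)).scomp t (hasDerivAt_neg t)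
    have h := forward (F := fun z => -F z) hF.neg (reverse hf) (reverse hg) (-t) (by linarith)
    simpa [abs_of_nonpos ht] using h

/-- The initial values of the global trajectories of a Lipschitz vector field which stay in a
closed set form a closed set. -/
theorem isClosed_setOf_trajectory_mem [CompleteSpace Z] {F : Z → Z} {K : ℝ≥0}
    (hF : LipschitzWith K F) {S : Set Z} (hS : IsClosed S) :
    IsClosed {z | ∃ f : ℝ → Z, f 0 = z ∧ (∀ t, HasDerivAt f (F (f t)) t) ∧ ∀ t, f t ∈ S} := by
  refine IsSeqClosed.isClosed fun z w hz hw => ?_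
  choose f hf0 hf hfS using hz
  have hlim : ∀ t, ∃ y, Tendsto (fun k => f k t) atTop (𝓝 y) := by
    intro t
    refine cauchySeq_tendsto_of_complete (Metric.cauchySeq_iff.2 fun ε hε => ?_)
    obtain ⟨N, hN⟩ := Metric.cauchySeq_iff.1 hw.cauchySeq (ε / Real.exp (K * |t|)) (by positivity)
    refine ⟨N, fun m hm k hk => ?_⟩
    have h := dist_le_of_global_trajectories hF (hf m) (hf k) t
    rw [hf0, hf0] at h
    exact h.trans_lt ((lt_div_iff₀ (Real.exp_pos _)).1 (hN m hm k hk))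
  choose g hg using hlim
  have hg0 : g 0 = w := tendsto_nhds_unique (hg 0) (by simpa [hf0] using hw)
  have hdist : ∀ k t, dist (f k t) (g t) ≤ dist (z k) w * Real.exp (K * |t|) := by
    intro k t
    refine le_of_tendsto_of_tendsto' (tendsto_const_nhds.dist (hg t))
      ((tendsto_const_nhds.dist hw).mul_const _) fun m => ?_
    simpa only [hf0] using dist_le_of_global_trajectories hF (hf k) (hf m) t
  refine ⟨g, hg0, fun t => ?_, fun t => hS.mem_of_tendsto (hg t) (.of_forall fun k => hfS k t)⟩
  have hunif : TendstoUniformlyOn (fun k s => F (f k s)) (fun s => F (g s)) atTop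
      (Metric.ball t 1) := by
    rw [Metric.tendstoUniformlyOn_iff]
    intro ε hε
    have hconv : Tendsto (fun k => K * (dist (z k) w * Real.exp (K * (|t| + 1)))) atTop (𝓝 0) := by
      have h := ((tendsto_iff_dist_tendsto_zero.1 hw).mul_const
        (Real.exp (K * (|t| + 1)))).const_mul (K : ℝ)
      simpa using h
    filter_upwards [hconv.eventually (gt_mem_nhds hε)] with k hk s hs
    have hs' : |s| ≤ |t| + 1 := by
      have h1 : |s - t| < 1 := by simpa [Real.dist_eq] using hs
      have h2 := abs_add_le (s - t) t
      rw [sub_add_cancel] at h2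
      linarith
    calc dist (F (g s)) (F (f k s)) = dist (F (f k s)) (F (g s)) := dist_comm _ _
      _ ≤ K * dist (f k s) (g s) := hF.dist_le_mul _ _
      _ ≤ K * (dist (z k) w * Real.exp (K * |s|)) := by gcongr; exact hdist k s
      _ ≤ K * (dist (z k) w * Real.exp (K * (|t| + 1))) := by gcongr
      _ < ε := hk
  exact hasDerivAt_of_tendstoUniformlyOn Metric.isOpen_ball hunif
    (.of_forall fun k s _ => hf k s) (fun s _ => hg s) (Metric.mem_ball_self one_pos)

end GlobalTrajectories

section Scattering

variable {H : Type*} [NormedAddCommGroup H] [InnerProductSpace ℝ H]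

/-- A trajectory of a second order system which is force-free outside a ball is unbounded if it is
outside of the ball at time `0` with nonzero outgoing velocity. -/
theorem not_bounded_of_outgoing {G : H → H} {K : ℝ≥0} (hG : LipschitzWith K G) {R : ℝ}
    (hR : 0 ≤ R) (hGR : ∀ y, R < ‖y‖ → G y = 0) {x ξ : ℝ → H}
    (hx : ∀ t, HasDerivAt x (ξ t) t) (hξ : ∀ t, HasDerivAt ξ (G (x t)) t)
    (h0 : R < ‖x 0‖) (hout : 0 ≤ inner ℝ (x 0) (ξ 0)) (hne : ξ 0 ≠ 0) (C : ℝ) :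
    ¬ ∀ t, ‖x t‖ ≤ C := by
  intro hC
  have hnorm : ∀ t : ℝ, ‖x 0 + t • ξ 0‖ ^ 2
      = ‖x 0‖ ^ 2 + 2 * t * inner ℝ (x 0) (ξ 0) + t ^ 2 * ‖ξ 0‖ ^ 2 := by
    intro t
    rw [norm_add_sq_real, inner_smul_right, norm_smul, mul_pow, Real.norm_eq_abs, sq_abs]
    ring
  have hline : ∀ t, 0 ≤ t → x t = x 0 + t • ξ 0 := by
    intro b hb
    have hF : LipschitzWith (max 1 (K * 1)) fun p : H × H => (p.2, G p.1) :=
      LipschitzWith.prod_snd.prodMk (hG.comp LipschitzWith.prod_fst)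
    have hsol : ∀ t, HasDerivAt (fun t => (x t, ξ t)) (ξ t, G (x t)) t := fun t =>
      (hx t).prodMk (hξ t)
    have hlin : ∀ t, HasDerivAt (fun t : ℝ => (x 0 + t • ξ 0, ξ 0)) (ξ 0, (0 : H)) t := by
      intro t
      have h := ((hasDerivAt_id t).smul_const (ξ 0)).const_add (x 0)
      exact HasDerivAt.prodMk (by simpa using h) (hasDerivAt_const t (ξ 0))
    have h := ODE_solution_unique (v := fun _ (p : H × H) => (p.2, G p.1)) (a := 0) (b := b)
      (f := fun t => (x t, ξ t)) (g := fun t => (x 0 + t • ξ 0, ξ 0)) (fun _ => hF)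
      (fun t _ => (hsol t).continuousAt.continuousWithinAt)
      (fun t _ => (hsol t).hasDerivWithinAt)
      (fun t _ => (hlin t).continuousAt.continuousWithinAt)
      (fun t ht => by
        have hR' : R < ‖x 0 + t • ξ 0‖ := by
          refine h0.trans_le (le_of_sq_le_sq ?_ (norm_nonneg _))
          rw [hnorm]
          have h1 : 0 ≤ 2 * t * inner ℝ (x 0) (ξ 0) := mul_nonneg (by linarith [ht.1]) hout
          nlinarith [sq_nonneg (t * ‖ξ 0‖)]
        simpa only [hGR _ hR'] using (hlin t).hasDerivWithinAt)
      (by simp)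
    exact congrArg Prod.fst (h ⟨hb, le_rfl⟩)
  have hpos : 0 < ‖ξ 0‖ := norm_pos_iff.2 hne
  have hC0 : 0 < C := (hR.trans_lt h0).trans_le (hC 0)
  have h1 := hC (C / ‖ξ 0‖)
  rw [hline _ (by positivity)] at h1
  have h2 := hnorm (C / ‖ξ 0‖)
  have h3 : (C / ‖ξ 0‖) ^ 2 * ‖ξ 0‖ ^ 2 = C ^ 2 := by field_simp
  have h4 : 0 ≤ 2 * (C / ‖ξ 0‖) * inner ℝ (x 0) (ξ 0) := mul_nonneg (by positivity) hout
  have h5 : ‖x 0 + (C / ‖ξ 0‖) • ξ 0‖ ^ 2 ≤ C ^ 2 := by gcongr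
  have h6 : 0 < ‖x 0‖ ^ 2 := by have := hR.trans_lt h0; positivity
  linarith

/-- A bounded trajectory of a second order system which is force-free outside a ball, with nonzero
velocity outside of the ball, never leaves the ball. -/
theorem norm_le_of_bounded_trajectory {G : H → H} {K : ℝ≥0} (hG : LipschitzWith K G) {R : ℝ}
    (hR : 0 ≤ R) (hGR : ∀ y, R < ‖y‖ → G y = 0) {x ξ : ℝ → H}
    (hx : ∀ t, HasDerivAt x (ξ t) t) (hξ : ∀ t, HasDerivAt ξ (G (x t)) t)
    (hne : ∀ t, R < ‖x t‖ → ξ t ≠ 0) {C : ℝ} (hC : ∀ t, ‖x t‖ ≤ C) (t : ℝ) : ‖x t‖ ≤ R := by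
  by_contra! ht
  rcases le_total 0 (inner ℝ (x t) (ξ t)) with h | h
  · exact not_bounded_of_outgoing hG hR hGR (x := fun s => x (t + s)) (ξ := fun s => ξ (t + s))
      (fun s => (hx (t + s)).comp_const_add t s) (fun s => (hξ (t + s)).comp_const_add t s)
      (by simpa using ht) (by simpa using h) (by simpa using hne t ht) C fun s => hC _
  · exact not_bounded_of_outgoing hG hR hGR (x := fun s => x (t - s)) (ξ := fun s => -ξ (t - s))
      (fun s => (hx (t - s)).comp_const_sub t s)
      (fun s => by simpa using ((hξ (t - s)).comp_const_sub t s).fun_neg)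
      (by simpa using ht) (by simpa [inner_neg_right] using h) (by simpa using hne t ht) C
      fun s => hC _

/-- Conservation of energy. -/
theorem energy_eq_of_trajectory [CompleteSpace H] {V : H → ℝ} (hV : Differentiable ℝ V)
    {x ξ : ℝ → H} (hx : ∀ t, HasDerivAt x (ξ t) t)
    (hξ : ∀ t, HasDerivAt ξ (-(gradient V (x t))) t) (t : ℝ) :
    ‖ξ t‖ ^ 2 / 2 + V (x t) = ‖ξ 0‖ ^ 2 / 2 + V (x 0) := by
  have hder : ∀ t, HasDerivAt (fun t => ‖ξ t‖ ^ 2 / 2 + V (x t)) 0 t := by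
    intro t
    have hVx := (hV (x t)).hasGradientAt.hasFDerivAt.comp_hasDerivAt t (hx t)
    refine (((hξ t).norm_sq.div_const 2).add hVx).congr_deriv ?_
    rw [InnerProductSpace.toDual_apply_apply, inner_neg_right, real_inner_comm (ξ t)]
    ring
  exact is_const_of_deriv_eq_zero (fun t => (hder t).differentiableAt) (fun t => (hder t).deriv) t 0

theorem gradient_eq_zero_of_norm_gt [CompleteSpace H] {V : H → ℝ} {R : ℝ}
    (hsupp : Function.support V ⊆ Metric.ball 0 R) {y : H} (hy : R < ‖y‖) :
    gradient V y = 0 := by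
  have h : V =ᶠ[𝓝 y] fun _ => 0 := by
    filter_upwards [(isOpen_lt continuous_const continuous_norm).mem_nhds hy] with w hw
    by_contra hne
    have := hsupp (Function.mem_support.2 hne)
    rw [mem_ball_zero_iff] at this
    exact absurd this (not_lt.2 (le_of_lt hw))
  rw [gradient, h.fderiv_eq]
  simp

theorem exists_lipschitzWith_gradient [CompleteSpace H] {V : H → ℝ} (hV : ContDiff ℝ 2 V)
    (hc : HasCompactSupport V) : ∃ K : ℝ≥0, LipschitzWith K (gradient V) := by
  obtain ⟨K, hK⟩ := (hV.fderiv_right (m := 1) (by norm_num)).lipschitzWith_of_hasCompactSupport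
    (hc.fderiv (𝕜 := ℝ)) one_ne_zero
  exact ⟨1 * K, (InnerProductSpace.toDual ℝ H).symm.lipschitz.comp hK⟩

end Scattering

/-- For every `E > 0`, the trapped set `K_E` is a compact subset of `ℝⁿ × ℝⁿ`. -/
theorem trappedSet_isCompact
    (n : ℕ) (hn : 1 ≤ n) (R₀ : ℝ) (hR₀ : 0 < R₀)
    (V : EuclideanSpace ℝ (Fin n) → ℝ)
    (hV : ContDiff ℝ (⊤ : ℕ∞) V)
    (hsupp : Function.support V ⊆ Metric.ball (0 : EuclideanSpace ℝ (Fin n)) R₀)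
    (E : ℝ) (hE : 0 < E) :
    IsCompact (trappedSet n V E) := by
  have hc : HasCompactSupport V :=
    .of_support_subset_isCompact (isCompact_closedBall 0 R₀)
      (hsupp.trans Metric.ball_subset_closedBall)
  obtain ⟨K, hK⟩ := exists_lipschitzWith_gradient (contDiff_infty.1 hV 2) hc
  have hF : LipschitzWith (max 1 (K * 1))
      fun p : EuclideanSpace ℝ (Fin n) × EuclideanSpace ℝ (Fin n) => (p.2, -gradient V p.1) :=
    LipschitzWith.prod_snd.prodMk (hK.neg.comp LipschitzWith.prod_fst)
  have hconf : ∀ x ξ : ℝ → EuclideanSpace ℝ (Fin n), (∀ t, HasDerivAt x (ξ t) t) →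
      (∀ t, HasDerivAt ξ (-(gradient V (x t))) t) → ‖ξ 0‖ ^ 2 / 2 + V (x 0) = E →
      (∃ C : ℝ, ∀ t, ‖x t‖ ≤ C) → ∀ t, ‖x t‖ ≤ R₀ := by
    rintro x ξ hx hξ h0 ⟨C, hC⟩
    refine norm_le_of_bounded_trajectory hK.neg hR₀.le (fun y hy => ?_) hx hξ
      (fun t ht hzero => ?_) hC
    · simp [gradient_eq_zero_of_norm_gt hsupp hy]
    · have hen := energy_eq_of_trajectory (hV.differentiable (by simp)) hx hξ t
      have hVt : V (x t) = 0 := by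
        by_contra hne
        have := mem_ball_zero_iff.1 (hsupp (Function.mem_support.2 hne))
        linarith
      rw [h0, hzero, hVt] at hen
      norm_num at hen
      linarith
  have hshell : IsClosed {p : EuclideanSpace ℝ (Fin n) × EuclideanSpace ℝ (Fin n) |
      ‖p.2‖ ^ 2 / 2 + V p.1 = E} := by
    have := hV.continuous
    exact isClosed_eq (by fun_prop) continuous_const
  have hball : IsClosed {p : EuclideanSpace ℝ (Fin n) × EuclideanSpace ℝ (Fin n) |
      ‖p.1‖ ≤ R₀} := isClosed_le (by fun_prop) continuous_const
  have heq : trappedSet n V E = {p | ‖p.2‖ ^ 2 / 2 + V p.1 = E} ∩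
      {p | ∃ f : ℝ → EuclideanSpace ℝ (Fin n) × EuclideanSpace ℝ (Fin n), f 0 = p ∧
        (∀ t, HasDerivAt f ((f t).2, -gradient V (f t).1) t) ∧ ∀ t, ‖(f t).1‖ ≤ R₀} := by
    ext p
    constructor
    · rintro ⟨hp, x, ξ, hx, hξ, hx0, hξ0, hb⟩
      exact ⟨hp, fun t => (x t, ξ t), by simp [hx0, hξ0], fun t => (hx t).prodMk (hξ t),
        hconf x ξ hx hξ (by rw [hx0, hξ0]; exact hp) hb⟩
    · rintro ⟨hp, f, rfl, hf, hb⟩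
      exact ⟨hp, fun t => (f t).1, fun t => (f t).2,
        fun t => (hasFDerivAt_fst (𝕜 := ℝ) (p := f t)).comp_hasDerivAt t (hf t),
        fun t => (hasFDerivAt_snd (𝕜 := ℝ) (p := f t)).comp_hasDerivAt t (hf t), rfl, rfl, R₀, hb⟩
  have hclosed : IsClosed (trappedSet n V E) := by
    rw [heq]
    exact hshell.inter (isClosed_setOf_trajectory_mem hF hball)
  obtain ⟨M, hM⟩ := hc.exists_bound_of_continuous hV.continuous
  refine ((isCompact_closedBall 0 R₀).prod
    (isCompact_closedBall 0 √(2 * (E + M)))).of_isClosed_subset hclosed ?_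
  rw [heq]
  rintro p ⟨hp, f, rfl, -, hb⟩
  refine ⟨by simpa using hb 0, ?_⟩
  rw [mem_closedBall_zero_iff]
  refine Real.le_sqrt_of_sq_le ?_
  have h1 := (abs_le.1 (hM (f 0).1)).1
  have h2 : ‖(f 0).2‖ ^ 2 / 2 + V (f 0).1 = E := hp
  linarith
end

section
/- Let Ω ⊆ ℂ be open, m, r ∈ ℕ, and let A(z) (m × m), R₋(z) (m × r), R₊(z) (r × m) be matrices depending holomorphically on z ∈ Ω (i.e., with holomorphic entries). Assume that for every z ∈ Ω the block matrix 𝒫(z) = [[A(z), R₋(z)], [R₊(z), 0]] is invertible, and let E₋₊(z) denote the lower-right r × r block of 𝒫(z)⁻¹. Then for every z₀ ∈ Ω, the order of vanishing of the holomorphic function z ↦ det A(z) at z₀ equals the order of vanishing of the holomorphic function z ↦ det E₋₊(z) at z₀. In particular, z₀ is a zero of det A if and only if it is a zero of det E₋₊, with the same multiplicity. -/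
open Filter

/-- `f` vanishes to order exactly `k` at `z₀`: `f(z) = (z − z₀)^k g(z)` near `z₀`
with `g` analytic at `z₀` and `g(z₀) ≠ 0`. -/
def VanishesToOrder (f : ℂ → ℂ) (z₀ : ℂ) (k : ℕ) : Prop :=
  ∃ g : ℂ → ℂ, AnalyticAt ℂ g z₀ ∧ g z₀ ≠ 0 ∧
    ∀ᶠ z in nhds z₀, f z = (z - z₀) ^ k * g z

/-- Jacobi's complementary minor identity for the leading block. -/
theorem Matrix.det_fromBlocks_mul_det_inv_toBlocks₂₂ {m n R : Type*} [Fintype m] [Fintype n]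
    [DecidableEq m] [DecidableEq n] [CommRing R] (A : Matrix m m R) (B : Matrix m n R)
    (C : Matrix n m R) (D : Matrix n n R) (h : IsUnit (Matrix.fromBlocks A B C D)) :
    (Matrix.fromBlocks A B C D).det * ((Matrix.fromBlocks A B C D)⁻¹).toBlocks₂₂.det = A.det := by
  set P := Matrix.fromBlocks A B C D with hP
  have hmul : P * P⁻¹ = 1 := Matrix.mul_nonsing_inv P ((Matrix.isUnit_iff_isUnit_det P).mp h)
  rw [← Matrix.fromBlocks_toBlocks P⁻¹, hP, Matrix.fromBlocks_multiply, ← Matrix.fromBlocks_one,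
    Matrix.fromBlocks_inj, ← hP] at hmul
  obtain ⟨-, h₁₂, -, h₂₂⟩ := hmul
  have key : P * Matrix.fromBlocks 1 P⁻¹.toBlocks₁₂ 0 P⁻¹.toBlocks₂₂ =
      Matrix.fromBlocks A 0 C 1 := by
    rw [hP, Matrix.fromBlocks_multiply, ← hP, h₁₂, h₂₂]
    simp
  simpa using congrArg Matrix.det key

theorem AnalyticAt.matrix_det {𝕜 E n : Type*} [NontriviallyNormedField 𝕜]
    [NormedAddCommGroup E] [NormedSpace 𝕜 E] [Fintype n] [DecidableEq n]
    {M : E → Matrix n n 𝕜} {x : E} (hM : ∀ i j, AnalyticAt 𝕜 (fun z => M z i j) x) :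
    AnalyticAt 𝕜 (fun z => (M z).det) x := by
  simp only [Matrix.det_apply']
  exact Finset.analyticAt_fun_sum _ fun σ _ =>
    analyticAt_const.mul (Finset.analyticAt_fun_prod _ fun i _ => hM _ _)

/-- Multiplication by a nonvanishing analytic function preserves the order of vanishing. -/
theorem VanishesToOrder.of_eventuallyEq_mul {f h u : ℂ → ℂ} {z₀ : ℂ} {k : ℕ}
    (hh : VanishesToOrder h z₀ k) (hu : AnalyticAt ℂ u z₀) (hu₀ : u z₀ ≠ 0)
    (hf : ∀ᶠ z in nhds z₀, f z = u z * h z) : VanishesToOrder f z₀ k := by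
  obtain ⟨g, hg, hg₀, hgh⟩ := hh
  refine ⟨fun z => u z * g z, hu.mul hg, mul_ne_zero hu₀ hg₀, ?_⟩
  filter_upwards [hf, hgh] with z h₁ h₂
  rw [h₁, h₂]
  ring

/-- Holomorphic Grushin problem: if the block matrices
`𝒫(z) = [[A(z), R₋(z)], [R₊(z), 0]]` are invertible for all `z ∈ Ω` and `E₋₊(z)` is
the lower-right block of `𝒫(z)⁻¹`, then at every `z₀ ∈ Ω` the order of vanishing of
`det A` equals that of `det E₋₊` (including the infinite-order case `f ≡ 0`
near `z₀`). -/
theorem order_of_vanishing_det_eq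
    (Ω : Set ℂ) (hΩ : IsOpen Ω) (m r : ℕ)
    (A : ℂ → Matrix (Fin m) (Fin m) ℂ)
    (Rm : ℂ → Matrix (Fin m) (Fin r) ℂ)
    (Rp : ℂ → Matrix (Fin r) (Fin m) ℂ)
    (hA : ∀ i j, DifferentiableOn ℂ (fun z => A z i j) Ω)
    (hRm : ∀ i j, DifferentiableOn ℂ (fun z => Rm z i j) Ω)
    (hRp : ∀ i j, DifferentiableOn ℂ (fun z => Rp z i j) Ω)
    (hinv : ∀ z ∈ Ω, IsUnit (Matrix.fromBlocks (A z) (Rm z) (Rp z) 0))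
    (Emp : ℂ → Matrix (Fin r) (Fin r) ℂ)
    (hEmp : ∀ z ∈ Ω, Emp z = ((Matrix.fromBlocks (A z) (Rm z) (Rp z) 0)⁻¹).toBlocks₂₂) :
    ∀ z₀ ∈ Ω,
      (∀ k : ℕ,
        VanishesToOrder (fun z => (A z).det) z₀ k ↔
        VanishesToOrder (fun z => (Emp z).det) z₀ k) ∧
      ((∀ᶠ z in nhds z₀, (A z).det = 0) ↔ (∀ᶠ z in nhds z₀, (Emp z).det = 0)) := by
  intro z₀ hz₀
  set u : ℂ → ℂ := fun z => (Matrix.fromBlocks (A z) (Rm z) (Rp z) 0).det with hu_def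
  have hΩ₀ : Ω ∈ nhds z₀ := hΩ.mem_nhds hz₀
  have hu : AnalyticAt ℂ u z₀ := by
    refine AnalyticAt.matrix_det fun i j => ?_
    rcases i with i | i <;> rcases j with j | j
    · exact (hA i j).analyticAt hΩ₀
    · exact (hRm i j).analyticAt hΩ₀
    · exact (hRp i j).analyticAt hΩ₀
    · exact analyticAt_const
  have hne : ∀ z ∈ Ω, u z ≠ 0 := fun z hz =>
    ((Matrix.isUnit_iff_isUnit_det _).mp (hinv z hz)).ne_zero
  have hdet : ∀ z ∈ Ω, (A z).det = u z * (Emp z).det := fun z hz => by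
    rw [hEmp z hz, hu_def, Matrix.det_fromBlocks_mul_det_inv_toBlocks₂₂ _ _ _ _ (hinv z hz)]
  refine ⟨fun k => ⟨fun h => ?_, fun h => ?_⟩, ?_⟩
  · refine h.of_eventuallyEq_mul (hu.inv (hne z₀ hz₀)) (inv_ne_zero (hne z₀ hz₀)) ?_
    filter_upwards [hΩ₀] with z hz
    rw [hdet z hz, Pi.inv_apply, inv_mul_cancel_left₀ (hne z hz)]
  · refine h.of_eventuallyEq_mul hu (hne z₀ hz₀) ?_
    filter_upwards [hΩ₀] with z hz using hdet z hz
  · refine eventually_congr ?_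
    filter_upwards [hΩ₀] with z hz
    rw [hdet z hz, mul_eq_zero, or_iff_right (hne z hz)]
end
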